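/- For τ in the upper half plane and z ∈ ℂ, the Mordell integral h(z;τ) = ∫_ℝ e^{πiτx² − 2πzx}/cosh(πx) dx satisfies h(z/τ; −1/τ) = √(−iτ) · e^{−πiz²/τ} · h(z;τ), where √ denotes the principal branch. -/

import Mathlib

open Complex
open scoped Real

/-- The Mordell integral `h(z; τ) = ∫_ℝ e^{πiτx² - 2πzx} / cosh(πx) dx`. -/
noncomputable def mordellH (z τ : ℂ) : ℂ :=
  ∫ x : ℝ, Complex.exp ((π : ℂ) * I * τ * (x : ℂ) ^ 2 - 2 * (π : ℂ) * z * (x : ℂ)) /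
    Complex.cosh ((π : ℂ) * (x : ℂ))

theorem sig_eq (t : ℝ) : Real.sigmoid (2 * π * t) = Real.exp (π * t) / (2 * Real.cosh (π * t)) := by
  rw [Real.sigmoid_def, Real.cosh_eq]
  have h1 : Real.exp (-(2 * π * t)) = Real.exp (-(π * t)) * Real.exp (-(π * t)) := by
    rw [← Real.exp_add]; ring_nf
  have h2 : Real.exp (π * t) * Real.exp (-(π * t)) = 1 := by
    rw [← Real.exp_add]; simp
  have := Real.exp_pos (π * t)
  have := Real.exp_pos (-(π * t))
  rw [h1]
  field_simp
  linear_combination -Real.exp (-(π * t)) * h2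

theorem one_sub_sig_eq (t : ℝ) :
    1 - Real.sigmoid (2 * π * t) = Real.exp (-(π * t)) / (2 * Real.cosh (π * t)) := by
  have h := sig_eq (-t)
  rw [mul_neg, Real.sigmoid_neg] at h
  simpa using h

theorem pointwise (t : ℝ) (w : ℂ) :
    |2 * π * (Real.sigmoid (2 * π * t) * (1 - Real.sigmoid (2 * π * t)))| •
      (((Real.sigmoid (2 * π * t) : ℝ) : ℂ) ^ (1 / 2 + w - 1) *
        (1 - ((Real.sigmoid (2 * π * t) : ℝ) : ℂ)) ^ (1 / 2 - w - 1)) =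
    π * (Complex.exp (2 * π * t * w) / Complex.cosh (π * t)) := by
  have hs := Real.sigmoid_pos (2 * π * t)
  have hs' : 0 < 1 - Real.sigmoid (2 * π * t) := by linarith [Real.sigmoid_lt_one (2 * π * t)]
  have e1 := sig_eq t
  have e2 := one_sub_sig_eq t
  have hc := Real.cosh_pos (π * t)
  rw [abs_of_pos (by positivity), Complex.real_smul]
  rw [← Complex.ofReal_one, ← Complex.ofReal_sub, Complex.ofReal_one]
  generalize Real.sigmoid (2 * π * t) = s at *
  generalize 1 - s = s' at *
  have hsc : (s : ℂ) ≠ 0 := by exact_mod_cast hs.ne'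
  have hsc' : (s' : ℂ) ≠ 0 := by exact_mod_cast hs'.ne'
  rw [cpow_sub _ _ hsc, cpow_sub _ _ hsc', cpow_one, cpow_one, cpow_def_of_ne_zero hsc,
    cpow_def_of_ne_zero hsc', ← ofReal_log hs.le, ← ofReal_log hs'.le]
  have l1 : Real.log s = π * t - Real.log (2 * Real.cosh (π * t)) := by
    rw [e1, Real.log_div (by positivity) (by positivity), Real.log_exp]
  have l2 : Real.log s' = -(π * t) - Real.log (2 * Real.cosh (π * t)) := by
    rw [e2, Real.log_div (by positivity) (by positivity), Real.log_exp]
  have key : cexp (Real.log s * (1 / 2 + w)) * cexp (Real.log s' * (1 / 2 - w)) =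
      cexp (2 * π * t * w) / (2 * Complex.cosh (π * t)) := by
    have : cexp (Real.log (2 * Real.cosh (π * t)) : ℝ) = 2 * Complex.cosh (π * t) := by
      rw [← ofReal_exp, Real.exp_log (by positivity)]; push_cast; rfl
    rw [← this, ← Complex.exp_add, ← Complex.exp_sub, l1, l2]
    congr 1; push_cast; ring
  have hcc : Complex.cosh (π * t) ≠ 0 := by
    rw [← ofReal_mul, ← ofReal_cosh]; exact_mod_cast hc.ne'
  rw [div_mul_div_comm, key]
  push_cast
  field_simp

open MeasureTheory Set in
theorem sech_facts (w : ℂ) (h1 : -(1/2) < w.re) (h2 : w.re < 1/2) :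
    Integrable (fun t : ℝ => Complex.exp (2 * π * t * w) / Complex.cosh (π * t)) ∧
    ∫ t : ℝ, Complex.exp (2 * π * t * w) / Complex.cosh (π * t) = 1 / Complex.cos (π * w) := by
  have hd : ∀ x ∈ (univ : Set ℝ), HasDerivWithinAt (fun t : ℝ => Real.sigmoid (2 * π * t))
      (2 * π * (Real.sigmoid (2 * π * x) * (1 - Real.sigmoid (2 * π * x)))) univ x := by
    intro x _
    have := (Real.hasDerivAt_sigmoid (2 * π * x)).comp x ((hasDerivAt_id x).const_mul (2 * π))
    exact (this.congr_deriv (by simp; ring)).hasDerivWithinAt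
  have hinj : InjOn (fun t : ℝ => Real.sigmoid (2 * π * t)) univ := by
    intro a _ b _ hab
    have := Real.sigmoid_injective hab
    have := Real.pi_pos
    simp_all
  have himg : (fun t : ℝ => Real.sigmoid (2 * π * t)) '' univ = Ioo 0 1 := by
    rw [← Real.range_sigmoid, image_univ]
    have : Function.Surjective (fun t : ℝ => 2 * π * t) :=
      mul_left_surjective₀ (by positivity)
    exact this.range_comp Real.sigmoid
  have hu : 0 < (1 / 2 + w).re := by simp; linarith
  have hv : 0 < (1 / 2 - w).re := by simp; linarith
  have hconv := betaIntegral_convergent hu hv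
  rw [intervalIntegrable_iff_integrableOn_Ioo_of_le zero_le_one, ← himg,
    integrableOn_image_iff_integrableOn_abs_deriv_smul MeasurableSet.univ hd hinj] at hconv
  have hint : betaIntegral (1 / 2 + w) (1 / 2 - w) =
      π * ∫ t : ℝ, Complex.exp (2 * π * t * w) / Complex.cosh (π * t) := by
    rw [betaIntegral, intervalIntegral.integral_of_le zero_le_one, integral_Ioc_eq_integral_Ioo,
      ← himg, integral_image_eq_integral_abs_deriv_smul MeasurableSet.univ hd hinj]
    simp only [pointwise, setIntegral_univ, integral_const_mul]
  have hpi : (π : ℂ) ≠ 0 := by exact_mod_cast Real.pi_ne_zero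
  constructor
  · simp only [pointwise, integrableOn_univ] at hconv
    exact (integrable_const_mul_iff (isUnit_iff_ne_zero.mpr hpi) _).1 hconv
  · have hG := Gamma_mul_Gamma_eq_betaIntegral hu hv
    have hR := Gamma_mul_Gamma_one_sub (1 / 2 + w)
    rw [show (1 : ℂ) - (1 / 2 + w) = 1 / 2 - w by ring, hG,
      show (1 / 2 + w + (1 / 2 - w) : ℂ) = 1 by ring, Gamma_one, one_mul, hint,
      show (π : ℂ) * (1 / 2 + w) = π * w + π / 2 by ring, Complex.sin_add_pi_div_two] at hR
    apply mul_left_cancel₀ hpi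
    rw [hR]; ring

open FourierTransform MeasureTheory in
theorem fourier_sech :
    𝓕 (fun t : ℝ => 1 / Complex.cosh (π * t)) = fun x : ℝ => 1 / Complex.cosh (π * x) := by
  ext x
  have := (sech_facts (-(x * I)) (by simp) (by simp)).2
  rw [Real.fourier_eq']
  rw [show (π : ℂ) * -(x * I) = -((π * x) * I) by ring, Complex.cos_neg, Complex.cos_mul_I] at this
  rw [← this]
  congr 1; ext t
  simp only [smul_eq_mul, RCLike.inner_apply, conj_trivial]
  rw [mul_one_div]
  congr 2
  push_cast; ring

open FourierTransform MeasureTheory in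
theorem mordell_modularity (τ z : ℂ) (hτ : 0 < τ.im) :
    mordellH (z / τ) (-1 / τ)
      = (-I * τ) ^ (1 / 2 : ℂ) * Complex.exp (-(π : ℂ) * I * z ^ 2 / τ) * mordellH z τ := by
  have hτ0 : τ ≠ 0 := by rintro rfl; simp at hτ
  have hb : 0 < (-I * τ).re := by simpa using hτ
  have hb0 : -I * τ ≠ 0 := by simp [hτ0]
  have hf : Integrable (fun t : ℝ => 1 / Complex.cosh (π * t)) := by
    simpa using (sech_facts 0 (by simp) (by simp)).1
  have hg : Integrable (fun x : ℝ => cexp (-π * (-I * τ) * x ^ 2 + 2 * π * (-z) * x)) := by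
    have := integrable_cexp_quadratic (b := π * (-I * τ)) (by
      rw [Complex.re_ofReal_mul]; exact mul_pos Real.pi_pos hb) (2 * π * (-z)) 0
    simpa [mul_assoc] using this
  have hsw : ∫ x : ℝ, (𝓕 (fun t : ℝ => 1 / Complex.cosh (π * t))) x •
      cexp (-π * (-I * τ) * x ^ 2 + 2 * π * (-z) * x) =
      ∫ x : ℝ, (1 / Complex.cosh (π * x)) •
        (𝓕 (fun x : ℝ => cexp (-π * (-I * τ) * x ^ 2 + 2 * π * (-z) * x))) x := by
    simpa using! (VectorFourier.integral_fourierIntegral_smul_eq_flip (L := innerₗ ℝ)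
      Real.continuous_fourierChar continuous_inner hf hg)
  rw [fourier_sech, fourier_gaussian_pi' hb] at hsw
  have hL : ∫ x : ℝ, (1 / Complex.cosh (π * x)) •
      cexp (-π * (-I * τ) * x ^ 2 + 2 * π * (-z) * x) = mordellH z τ := by
    unfold mordellH
    congr 1; ext x
    rw [smul_eq_mul, one_div_mul_eq_div]
    congr 2; ring
  have hc : (-I * τ) ^ (1 / 2 : ℂ) ≠ 0 := by simp [cpow_eq_zero_iff, hτ0]
  have hR : ∫ x : ℝ, (1 / Complex.cosh (π * x)) •
      (1 / (-I * τ) ^ (1 / 2 : ℂ) * cexp (-π / (-I * τ) * (x + I * -z) ^ 2)) =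
      (1 / (-I * τ) ^ (1 / 2 : ℂ) * cexp (π * I * z ^ 2 / τ)) * mordellH (z / τ) (-1 / τ) := by
    unfold mordellH
    rw [← integral_const_mul]
    congr 1; ext x
    have : cexp (-π / (-I * τ) * (x + I * -z) ^ 2) = cexp (π * I * z ^ 2 / τ) *
        cexp (π * I * (-1 / τ) * x ^ 2 - 2 * π * (z / τ) * x) := by
      rw [← Complex.exp_add]
      congr 1
      have : -(π : ℂ) / (-I * τ) = - π * I / τ := by
        field_simp
        simp
      rw [this]
      field_simp
      linear_combination (2 * x * z - I * z ^ 2) * I_sq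
    rw [this, smul_eq_mul]
    ring
  rw [hL, hR] at hsw
  rw [hsw]
  have : cexp (-π * I * z ^ 2 / τ) * cexp (π * I * z ^ 2 / τ) = 1 := by
    rw [← Complex.exp_add, ← Complex.exp_zero]; congr 1; ring
  have h2 : (-I * τ) ^ (1 / 2 : ℂ) * (1 / (-I * τ) ^ (1 / 2 : ℂ)) = 1 := by
    rw [mul_one_div_cancel hc]
  generalize (-I * τ) ^ (1 / 2 : ℂ) = c at *
  generalize mordellH (z / τ) (-1 / τ) = m at *
  linear_combination -m * c * (1 / c) * this - m * h2
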